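/- Let 0 < μ < L and let (x_i, g_i, f_i)_{i∈I} be a finite family in E × E × ℝ. For every pair (i, j) ∈ I × I, the function η ↦ Q^set_{η²μ, η²L}(i,j)(η) converges as η → 0⁺ to a limit ℓ_{ij} ∈ ℝ, and the family (x_i, g_i, f_i)_{i∈I} is F_{μ,L}-interpolable if and only if ℓ_{ij} ≥ 0 for all i, j ∈ I. -/

import Mathlib

open Metric Set Filter
open scoped RealInnerProductSpace

noncomputable section

/-- The point `ζ_i(η) = (x_i/η, f_i)` in `E × ℝ` with the `ℓ²` product structure. -/
def zetaPt {d : ℕ} (x : EuclideanSpace ℝ (Fin d)) (f η : ℝ) :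
    WithLp 2 (EuclideanSpace ℝ (Fin d) × ℝ) :=
  (WithLp.equiv 2 (EuclideanSpace ℝ (Fin d) × ℝ)).symm (η⁻¹ • x, f)

/-- The unit vector `ν_i(η) = (η g_i, -1) / ‖(η g_i, -1)‖` in `E × ℝ`. -/
def nuVec {d : ℕ} (g : EuclideanSpace ℝ (Fin d)) (η : ℝ) :
    WithLp 2 (EuclideanSpace ℝ (Fin d) × ℝ) :=
  ‖(WithLp.equiv 2 (EuclideanSpace ℝ (Fin d) × ℝ)).symm (η • g, (-1 : ℝ))‖⁻¹ •
    (WithLp.equiv 2 (EuclideanSpace ℝ (Fin d) × ℝ)).symm (η • g, (-1 : ℝ))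

/-- The set-interpolation quantity
`Q^set_{a,b}(i,j)(η) = (a/(2(1-a/b))) ((1/a-1/b)² - ‖ζ_j - (1/b)ν_j - ζ_i + (1/a)ν_i‖²)`. -/
def Qset {d : ℕ} (a b : ℝ) (xi gi : EuclideanSpace ℝ (Fin d)) (fi : ℝ)
    (xj gj : EuclideanSpace ℝ (Fin d)) (fj : ℝ) (η : ℝ) : ℝ :=
  a / (2 * (1 - a / b)) *
    ((1 / a - 1 / b) ^ 2 -
      ‖zetaPt xj fj η - (1 / b) • nuVec gj η - zetaPt xi fi η + (1 / a) • nuVec gi η‖ ^ 2)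

/-- `g` is a subgradient of `f` at `x`. -/
def IsSubgradientOf {d : ℕ} (f : EuclideanSpace ℝ (Fin d) → ℝ)
    (g x : EuclideanSpace ℝ (Fin d)) : Prop :=
  ∀ u, f x + ⟪g, u - x⟫ ≤ f u

/-- The class `F_{μ,L}` of `μ`-strongly convex, `L`-smooth convex functions. -/
def MemFclass {d : ℕ} (μ L : ℝ) (f : EuclideanSpace ℝ (Fin d) → ℝ) : Prop :=
  ConvexOn ℝ Set.univ f ∧
  ∀ x y g, IsSubgradientOf f g x →
    f y ≤ f x + ⟪g, y - x⟫ + L / 2 * ‖y - x‖ ^ 2 ∧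
    f x + ⟪g, y - x⟫ + μ / 2 * ‖y - x‖ ^ 2 ≤ f y

/-- A family `(x_i, g_i, f_i)` is `F_{μ,L}`-interpolable. -/
def FInterpolable {d : ℕ} {ι : Type*} (μ L : ℝ) (x g : ι → EuclideanSpace ℝ (Fin d))
    (fv : ι → ℝ) : Prop :=
  ∃ f : EuclideanSpace ℝ (Fin d) → ℝ, MemFclass μ L f ∧
    ∀ i, f (x i) = fv i ∧ IsSubgradientOf f (g i) (x i)

open Topology

section Limit

variable {d : ℕ}

local notation "E" => EuclideanSpace ℝ (Fin d)

/-- The last coordinate of `nuVec`, up to sign. -/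
def nuScale (g : E) (η : ℝ) : ℝ := (√(1 + η ^ 2 * ‖g‖ ^ 2))⁻¹

lemma nuScale_pos (g : E) (η : ℝ) : 0 < nuScale g η := by
  unfold nuScale; positivity

lemma nuScale_sq (g : E) (η : ℝ) : nuScale g η ^ 2 * (1 + η ^ 2 * ‖g‖ ^ 2) = 1 := by
  have h : 0 < 1 + η ^ 2 * ‖g‖ ^ 2 := by positivity
  rw [nuScale, inv_pow, Real.sq_sqrt h.le, inv_mul_cancel₀ h.ne']

lemma continuous_nuScale (g : E) : Continuous (nuScale g) := by
  unfold nuScale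
  refine Continuous.inv₀ (by fun_prop) fun η => ?_
  positivity

lemma nuScale_zero (g : E) : nuScale g 0 = 1 := by simp [nuScale]

lemma nuVec_eq (g : E) (η : ℝ) :
    nuVec g η = WithLp.toLp 2 ((nuScale g η * η) • g, -nuScale g η) := by
  have h : ‖WithLp.toLp 2 (η • g, (-1 : ℝ))‖⁻¹ = nuScale g η := by
    rw [nuScale, ← Real.sqrt_sq (norm_nonneg (WithLp.toLp 2 (η • g, (-1 : ℝ)))),
      WithLp.prod_norm_sq_eq_of_L2]
    simp [norm_smul, mul_pow, add_comm]
  simp only [nuVec, WithLp.equiv_symm_apply, h]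
  rw [← WithLp.toLp_smul, Prod.smul_mk, smul_smul, smul_eq_mul, mul_neg_one]

/-- `(1 - nuScale g η) / η ^ 2`, written so that it extends continuously to `η = 0`. -/
def nuDefect (g : E) (η : ℝ) : ℝ := ‖g‖ ^ 2 * nuScale g η ^ 2 / (1 + nuScale g η)

lemma sq_mul_nuDefect (g : E) (η : ℝ) : η ^ 2 * nuDefect g η = 1 - nuScale g η := by
  have h := nuScale_sq g η
  have h0 := nuScale_pos g η
  rw [nuDefect, ← mul_div_assoc, div_eq_iff (by positivity)]
  linear_combination h

lemma continuous_nuDefect (g : E) : Continuous (nuDefect g) := by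
  have := continuous_nuScale g
  unfold nuDefect
  refine Continuous.div (by fun_prop) (by fun_prop) fun η => ?_
  have := nuScale_pos g η
  positivity

lemma Qset_eq {μ L η : ℝ} (hμ : 0 < μ) (hμL : μ < L) (hη : 0 < η)
    (xi gi : E) (fi : ℝ) (xj gj : E) (fj : ℝ) :
    Qset (η ^ 2 * μ) (η ^ 2 * L) xi gi fi xj gj fj η =
      μ * L / (2 * (L - μ)) *
        ((nuDefect gi η / μ - nuDefect gj η / L) *
            ((1 + nuScale gi η) / μ - (1 + nuScale gj η) / L) -
          ‖xj - xi - (nuScale gj η / L) • gj + (nuScale gi η / μ) • gi‖ ^ 2 -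
          2 * (fj - fi) * (nuScale gj η / L - nuScale gi η / μ) - η ^ 2 * (fj - fi) ^ 2) := by
  have hL : 0 < L := hμ.trans hμL
  have hLμ : L - μ ≠ 0 := (sub_pos.2 hμL).ne'
  have hvec : zetaPt xj fj η - (1 / (η ^ 2 * L)) • nuVec gj η - zetaPt xi fi η +
      (1 / (η ^ 2 * μ)) • nuVec gi η =
      WithLp.toLp 2 (η⁻¹ • (xj - xi - (nuScale gj η / L) • gj + (nuScale gi η / μ) • gi),
        fj - fi + (nuScale gj η / L - nuScale gi η / μ) / η ^ 2) := by
    rw [nuVec_eq, nuVec_eq]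
    simp only [zetaPt, WithLp.equiv_symm_apply, ← WithLp.toLp_smul, ← WithLp.toLp_sub,
      ← WithLp.toLp_add, Prod.smul_mk, Prod.mk_sub_mk, Prod.mk_add_mk]
    congr 2
    · match_scalars <;> field_simp
    · simp only [smul_eq_mul]
      field_simp
      ring
  rw [Qset, hvec, WithLp.prod_norm_sq_eq_of_L2]
  simp only [WithLp.toLp_fst, WithLp.toLp_snd, norm_smul, Real.norm_eq_abs, mul_pow, sq_abs]
  generalize ‖xj - xi - (nuScale gj η / L) • gj + (nuScale gi η / μ) • gi‖ ^ 2 = N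
  have hi : nuDefect gi η = (1 - nuScale gi η) / η ^ 2 := by
    rw [← sq_mul_nuDefect]; field_simp
  have hj : nuDefect gj η = (1 - nuScale gj η) / η ^ 2 := by
    rw [← sq_mul_nuDefect]; field_simp
  rw [hi, hj]
  have hc : η ^ 2 * μ / (2 * (1 - η ^ 2 * μ / (η ^ 2 * L))) = η ^ 2 * (μ * L / (2 * (L - μ))) := by
    field_simp
  rw [hc]
  generalize μ * L / (2 * (L - μ)) = C
  field_simp
  ring

/-- The interpolation gap of `F_{μ,L}` for an ordered pair of data triples. -/
def interpGap (μ L : ℝ) (xi gi : E) (fi : ℝ) (xj gj : E) (fj : ℝ) : ℝ :=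
  fj - fi + (‖gi‖ ^ 2 / μ - ‖gj‖ ^ 2 / L) / 2 -
    μ * L / (2 * (L - μ)) * ‖xj - xi - L⁻¹ • gj + μ⁻¹ • gi‖ ^ 2

lemma tendsto_Qset {μ L : ℝ} (hμ : 0 < μ) (hμL : μ < L)
    (xi gi : E) (fi : ℝ) (xj gj : E) (fj : ℝ) :
    Tendsto (fun η : ℝ => Qset (η ^ 2 * μ) (η ^ 2 * L) xi gi fi xj gj fj η)
      (𝓝[>] 0) (𝓝 (interpGap μ L xi gi fi xj gj fj)) := by
  have hL : 0 < L := hμ.trans hμL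
  have hLμ : L - μ ≠ 0 := (sub_pos.2 hμL).ne'
  have c1 := continuous_nuScale gi
  have c2 := continuous_nuScale gj
  have c3 := continuous_nuDefect gi
  have c4 := continuous_nuDefect gj
  refine Tendsto.congr' (eventually_nhdsWithin_of_forall fun η hη =>
    (Qset_eq hμ hμL hη xi gi fi xj gj fj).symm) ?_
  refine Tendsto.mono_left ?_ nhdsWithin_le_nhds
  refine Continuous.tendsto' (by fun_prop) _ _ ?_
  simp only [nuDefect, nuScale_zero, interpGap, one_div]
  field_simp
  ring

end Limit

section Interpolation

variable {d : ℕ}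

local notation "E" => EuclideanSpace ℝ (Fin d)

lemma quadratic_max_eq {μ L : ℝ} (hμL : μ < L) (A B : E) :
    μ / 2 * ‖(L / (L - μ)) • (B - A)‖ ^ 2 - L / 2 * ‖(μ / (L - μ)) • (B - A)‖ ^ 2 =
      μ * L / (2 * (L - μ)) * ‖B - A‖ ^ 2 := by
  have hLμ : L - μ ≠ 0 := (sub_pos.2 hμL).ne'
  simp only [norm_smul, mul_pow, Real.norm_eq_abs, sq_abs]
  field_simp

lemma complete_square {c : ℝ} (hc : c ≠ 0) (g w : E) :
    ⟪g, w⟫ + c / 2 * ‖w‖ ^ 2 = c / 2 * ‖w + c⁻¹ • g‖ ^ 2 - ‖g‖ ^ 2 / c / 2 := by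
  rw [norm_add_sq_real, norm_smul, mul_pow, Real.norm_eq_abs, sq_abs, inner_smul_right,
    real_inner_comm]
  field_simp
  ring

lemma interpGap_nonneg_of_memFclass {μ L : ℝ} (hμ : 0 < μ) (hμL : μ < L) {f : E → ℝ}
    (hf : MemFclass μ L f) {xi gi xj gj : E} (hi : IsSubgradientOf f gi xi)
    (hj : IsSubgradientOf f gj xj) :
    0 ≤ interpGap μ L xi gi (f xi) xj gj (f xj) := by
  have hL : 0 < L := hμ.trans hμL
  have hLμ : L - μ ≠ 0 := (sub_pos.2 hμL).ne'
  set A := xi - μ⁻¹ • gi with hA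
  set B := xj - L⁻¹ • gj with hB
  set z := A + (L / (L - μ)) • (B - A) with hz
  have hzA : z - xi + μ⁻¹ • gi = (L / (L - μ)) • (B - A) := by
    rw [hz, hA]; abel
  have hzB : z - xj + L⁻¹ • gj = (μ / (L - μ)) • (B - A) := by
    have h1 : z - xj + L⁻¹ • gj = z - B := by rw [hB]; abel
    rw [h1, hz]
    match_scalars <;> field_simp <;> ring
  have hlow := (hf.2 xi z gi hi).2
  have hup := (hf.2 xj z gj hj).1
  have hsi := complete_square hμ.ne' gi (z - xi)
  have hsj := complete_square hL.ne' gj (z - xj)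
  have hq := quadratic_max_eq hμL A B
  have hBA : xj - xi - L⁻¹ • gj + μ⁻¹ • gi = B - A := by rw [hA, hB]; abel
  rw [hzA] at hsi
  rw [hzB] at hsj
  rw [interpGap, hBA]
  linarith

/-- If a linear functional is dominated by a quadratic form, it vanishes. -/
lemma eq_of_inner_le_inner_add_sq {M : ℝ} {g q : E}
    (h : ∀ w : E, ⟪g, w⟫ ≤ ⟪q, w⟫ + M * ‖w‖ ^ 2) : g = q := by
  have key : ∀ t : ℝ, 0 < t → ‖g - q‖ ^ 2 ≤ t * (M * ‖g - q‖ ^ 2) := by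
    intro t ht
    have h1 := h (t • (g - q))
    rw [inner_smul_right, inner_smul_right, norm_smul, mul_pow, Real.norm_eq_abs, sq_abs] at h1
    have h2 : ⟪g, g - q⟫ - ⟪q, g - q⟫ = ‖g - q‖ ^ 2 := by
      rw [← inner_sub_left, real_inner_self_eq_norm_sq]
    refine le_of_mul_le_mul_left ?_ ht
    rw [← h2] at h1 ⊢
    linarith
  have hlim : Tendsto (fun t : ℝ => t * (M * ‖g - q‖ ^ 2)) (𝓝[>] 0) (𝓝 0) :=
    ((continuous_mul_const _).tendsto' 0 0 (zero_mul _)).mono_left nhdsWithin_le_nhds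
  have h0 := ge_of_tendsto hlim (eventually_nhdsWithin_of_forall key)
  have : ‖g - q‖ = 0 := by nlinarith [norm_nonneg (g - q)]
  exact sub_eq_zero.1 (norm_eq_zero.1 this)

lemma convexOn_of_forall_exists_isSubgradientOf {f : E → ℝ}
    (h : ∀ x, ∃ q, IsSubgradientOf f q x) : ConvexOn ℝ Set.univ f := by
  refine ⟨convex_univ, fun x _ y _ a b ha hb hab => ?_⟩
  obtain ⟨q, hq⟩ := h (a • x + b • y)
  have h1 := mul_le_mul_of_nonneg_left (hq x) ha
  have h2 := mul_le_mul_of_nonneg_left (hq y) hb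
  have h3 : a * ⟪q, x - (a • x + b • y)⟫ + b * ⟪q, y - (a • x + b • y)⟫ = 0 := by
    simp only [inner_sub_right, inner_add_right, inner_smul_right]
    obtain rfl : b = 1 - a := by linarith
    ring
  have h4 : f (a • x + b • y) = a * f (a • x + b • y) + b * f (a • x + b • y) := by
    rw [← add_mul, hab, one_mul]
  simp only [smul_eq_mul]
  linarith

lemma memFclass_of_quadratic_bounds {μ L : ℝ} (hμ : 0 ≤ μ) {f : E → ℝ}
    (h : ∀ x, ∃ q, ∀ y, f y ≤ f x + ⟪q, y - x⟫ + L / 2 * ‖y - x‖ ^ 2 ∧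
      f x + ⟪q, y - x⟫ + μ / 2 * ‖y - x‖ ^ 2 ≤ f y) : MemFclass μ L f := by
  refine ⟨convexOn_of_forall_exists_isSubgradientOf fun x => ?_, fun x y g hg => ?_⟩
  · obtain ⟨q, hq⟩ := h x
    refine ⟨q, fun u => ?_⟩
    have : 0 ≤ μ / 2 * ‖u - x‖ ^ 2 := by positivity
    linarith [(hq u).2]
  · obtain ⟨q, hq⟩ := h x
    obtain rfl : g = q := eq_of_inner_le_inner_add_sq (M := L / 2) fun w => by
      have h1 := hg (x + w)
      have h2 := (hq (x + w)).1
      rw [add_sub_cancel_left] at h1 h2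
      linarith
    exact hq y

/-- The concave objective whose maximum over a convex set of pairs (slope, intercept) is a
convex function that is smooth with constant `M`. -/
def smoothObj (M : ℝ) (k : E × ℝ) (x : E) : ℝ := k.2 + ⟪k.1, x⟫ - ‖k.1‖ ^ 2 / (2 * M)

lemma smoothObj_le_of_isMaxOn {M : ℝ} (hM : 0 < M) {K : Set (E × ℝ)} (hK : Convex ℝ K) {x : E}
    {m : E × ℝ} (hm : m ∈ K) (hmax : ∀ k ∈ K, smoothObj M k x ≤ smoothObj M m x)
    {k : E × ℝ} (hk : k ∈ K) (y : E) :
    smoothObj M k y ≤ smoothObj M m x + ⟪m.1, y - x⟫ + M / 2 * ‖y - x‖ ^ 2 := by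
  set w := k.1 - m.1 with hw
  set D := k.2 - m.2 + ⟪w, x⟫ - ⟪m.1, w⟫ / M with hD
  have hkw : k.1 = m.1 + w := by rw [hw]; abel
  have hfo : D ≤ 0 := by
    have key : ∀ t ∈ Set.Ioo (0 : ℝ) 1, D ≤ t * (‖w‖ ^ 2 / (2 * M)) := by
      intro t ht
      have h1 := hmax _ (hK.add_smul_sub_mem hm hk ⟨ht.1.le, ht.2.le⟩)
      simp only [smoothObj, Prod.fst_add, Prod.snd_add, Prod.smul_fst, Prod.smul_snd,
        Prod.fst_sub, Prod.snd_sub, ← hw, smul_eq_mul, inner_add_left, inner_smul_left,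
        norm_add_sq_real, inner_smul_right, norm_smul, mul_pow, Real.norm_eq_abs, sq_abs,
        conj_trivial] at h1
      refine le_of_mul_le_mul_left ?_ ht.1
      have h2 : (‖m.1‖ ^ 2 + 2 * (t * ⟪m.1, w⟫) + t ^ 2 * ‖w‖ ^ 2) / (2 * M) =
          ‖m.1‖ ^ 2 / (2 * M) + t * (⟪m.1, w⟫ / M) + t * (t * (‖w‖ ^ 2 / (2 * M))) := by
        field_simp
      rw [h2] at h1
      rw [hD]
      linarith
    have hlim : Tendsto (fun t : ℝ => t * (‖w‖ ^ 2 / (2 * M))) (𝓝[>] 0) (𝓝 0) :=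
      ((continuous_mul_const _).tendsto' 0 0 (zero_mul _)).mono_left nhdsWithin_le_nhds
    refine ge_of_tendsto hlim ?_
    filter_upwards [Ioo_mem_nhdsGT one_pos] with t ht using key t ht
  have hsq : 0 ≤ M / 2 * ‖y - x - M⁻¹ • w‖ ^ 2 := by positivity
  have hexp : M / 2 * ‖y - x - M⁻¹ • w‖ ^ 2 =
      M / 2 * ‖y - x‖ ^ 2 - ⟪w, y - x⟫ + ‖w‖ ^ 2 / (2 * M) := by
    rw [norm_sub_sq_real, norm_smul, mul_pow, Real.norm_eq_abs, sq_abs, inner_smul_right,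
      real_inner_comm]
    field_simp
  have hk1 : ‖k.1‖ ^ 2 / (2 * M) =
      ‖m.1‖ ^ 2 / (2 * M) + ⟪m.1, w⟫ / M + ‖w‖ ^ 2 / (2 * M) := by
    rw [hkw, norm_add_sq_real]
    field_simp
  have hki : ⟪k.1, y⟫ = ⟪m.1, x⟫ + ⟪m.1, y - x⟫ + ⟪w, x⟫ + ⟪w, y - x⟫ := by
    rw [hkw]
    simp only [inner_add_left, inner_sub_right]
    ring
  simp only [smoothObj, hk1, hki]
  linarith

lemma exists_memFclass_isMaxOn_smoothObj {μ L : ℝ} (hμ : 0 ≤ μ) (hμL : μ < L)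
    {K : Set (E × ℝ)} (hK : Convex ℝ K) (hKc : IsCompact K) (hKn : K.Nonempty) :
    ∃ f : E → ℝ, MemFclass μ L f ∧
      ∀ x, ∃ m ∈ K, f x = smoothObj (L - μ) m x + μ / 2 * ‖x‖ ^ 2 ∧
        ∀ k ∈ K, smoothObj (L - μ) k x ≤ smoothObj (L - μ) m x := by
  have hex : ∀ x : E, ∃ m ∈ K, ∀ k ∈ K, smoothObj (L - μ) k x ≤ smoothObj (L - μ) m x := by
    intro x
    have hc : Continuous fun k : E × ℝ => smoothObj (L - μ) k x := by
      unfold smoothObj; fun_prop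
    exact hKc.exists_isMaxOn hKn hc.continuousOn
  choose m hmK hmax using hex
  refine ⟨fun x => smoothObj (L - μ) (m x) x + μ / 2 * ‖x‖ ^ 2,
    memFclass_of_quadratic_bounds hμ fun x => ⟨(m x).1 + μ • x, fun y => ?_⟩,
    fun x => ⟨m x, hmK x, rfl, hmax x⟩⟩
  have hy : ‖y‖ ^ 2 = ‖x‖ ^ 2 + 2 * ⟪x, y - x⟫ + ‖y - x‖ ^ 2 := by
    rw [← norm_add_sq_real, add_sub_cancel]
  have hlow := hmax y (m x) (hmK x)
  have hlin : smoothObj (L - μ) (m x) y = smoothObj (L - μ) (m x) x + ⟪(m x).1, y - x⟫ := by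
    simp only [smoothObj, inner_sub_right]
    ring
  have hup := smoothObj_le_of_isMaxOn (sub_pos.2 hμL) hK (hmK x) (hmax x) (hmK y) y
  simp only [inner_add_left, inner_smul_left, conj_trivial, hy]
  constructor
  · linarith
  · linarith

/-- The slope and intercept of a data triple after removing the quadratic `μ / 2 * ‖·‖ ^ 2`. -/
def shiftedDatum (μ L : ℝ) (x g : E) (f : ℝ) : E × ℝ :=
  (g - μ • x, f - μ / 2 * ‖x‖ ^ 2 - ⟪g - μ • x, x⟫ + ‖g - μ • x‖ ^ 2 / (2 * (L - μ)))

lemma smoothObj_shiftedDatum (μ L : ℝ) (x g : E) (f : ℝ) (y : E) :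
    smoothObj (L - μ) (shiftedDatum μ L x g f) y + μ / 2 * ‖y‖ ^ 2 =
      f + ⟪g, y - x⟫ + μ / 2 * ‖y - x‖ ^ 2 := by
  simp only [smoothObj, shiftedDatum, norm_sub_sq_real y x, inner_sub_left, inner_sub_right,
    inner_smul_left, conj_trivial, real_inner_self_eq_norm_sq, real_inner_comm x y]
  ring

lemma shiftedDatum_halfspace {μ L : ℝ} (hμ : 0 < μ) (hμL : μ < L) {xi gi : E} {fi : ℝ}
    {xj gj : E} {fj : ℝ} (h : 0 ≤ interpGap μ L xi gi fi xj gj fj) :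
    (shiftedDatum μ L xi gi fi).2 +
        ⟪xj - (L - μ)⁻¹ • (gj - μ • xj), (shiftedDatum μ L xi gi fi).1⟫ ≤
      fj - μ / 2 * ‖xj‖ ^ 2 - ‖gj - μ • xj‖ ^ 2 / (2 * (L - μ)) := by
  have hL : 0 < L := hμ.trans hμL
  have hLμ : L - μ ≠ 0 := (sub_pos.2 hμL).ne'
  rw [← sub_nonneg]
  convert h using 1
  simp only [interpGap, shiftedDatum, ← real_inner_self_eq_norm_sq, inner_sub_left,
    inner_sub_right, inner_add_left, inner_add_right, inner_smul_left, inner_smul_right,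
    conj_trivial]
  rw [real_inner_comm xj xi, real_inner_comm xj gi, real_inner_comm xj gj,
    real_inner_comm xi gi, real_inner_comm xi gj, real_inner_comm gi gj]
  field_simp
  ring

lemma smoothObj_le_of_halfspace {M : ℝ} (hM : 0 < M) {k : E × ℝ} {x u : E} {c : ℝ}
    (h : k.2 + ⟪x - M⁻¹ • u, k.1⟫ ≤ c - ‖u‖ ^ 2 / (2 * M)) : smoothObj M k x ≤ c := by
  have hsq : 0 ≤ ‖k.1 - u‖ ^ 2 / (2 * M) := by positivity
  have hexp : ‖k.1 - u‖ ^ 2 / (2 * M) =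
      ‖k.1‖ ^ 2 / (2 * M) - M⁻¹ * ⟪u, k.1⟫ + ‖u‖ ^ 2 / (2 * M) := by
    rw [norm_sub_sq_real, real_inner_comm]
    field_simp
  rw [inner_sub_left, inner_smul_left, conj_trivial, real_inner_comm] at h
  simp only [smoothObj]
  linarith

lemma fInterpolable_of_interpGap_nonneg {ι : Type*} [Finite ι] {μ L : ℝ} (hμ : 0 < μ)
    (hμL : μ < L) {x g : ι → E} {fv : ι → ℝ}
    (h : ∀ i j, 0 ≤ interpGap μ L (x i) (g i) (fv i) (x j) (g j) (fv j)) :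
    FInterpolable μ L x g fv := by
  cases isEmpty_or_nonempty ι with
  | inl _ =>
    obtain ⟨f, hf, -⟩ := exists_memFclass_isMaxOn_smoothObj (d := d) hμ.le hμL
      (convex_singleton 0) isCompact_singleton (Set.singleton_nonempty 0)
    exact ⟨f, hf, isEmptyElim⟩
  | inr _ =>
    set p : ι → E × ℝ := fun i => shiftedDatum μ L (x i) (g i) (fv i) with hp
    have hpK : ∀ i, p i ∈ convexHull ℝ (Set.range p) := fun i =>
      subset_convexHull ℝ _ (Set.mem_range_self i)
    obtain ⟨f, hf, hmax⟩ := exists_memFclass_isMaxOn_smoothObj hμ.le hμL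
      (convex_convexHull ℝ (Set.range p)) ((Set.finite_range p).isCompact_convexHull ℝ)
      (Set.range_nonempty p).convexHull
    have hlow : ∀ i y, fv i + ⟪g i, y - x i⟫ + μ / 2 * ‖y - x i‖ ^ 2 ≤ f y := by
      intro i y
      obtain ⟨m, -, hfm, hm⟩ := hmax y
      rw [hfm, ← smoothObj_shiftedDatum μ L]
      linarith [hm _ (hpK i)]
    have hle : ∀ j, f (x j) ≤ fv j := by
      intro j
      obtain ⟨m, hmK, hfm, -⟩ := hmax (x j)
      set u := g j - μ • x j with hu
      set c := fv j - μ / 2 * ‖x j‖ ^ 2 with hc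
      have hlin : IsLinearMap ℝ fun k : E × ℝ =>
          k.2 + ⟪x j - (L - μ)⁻¹ • u, k.1⟫ := by
        constructor
        · intro k l
          simp only [Prod.fst_add, Prod.snd_add, inner_add_right]
          ring
        · intro r k
          simp only [Prod.smul_fst, Prod.smul_snd, inner_smul_right, smul_eq_mul]
          ring
      have hsub : Set.range p ⊆ {k | k.2 + ⟪x j - (L - μ)⁻¹ • u, k.1⟫ ≤
          c - ‖u‖ ^ 2 / (2 * (L - μ))} :=
        Set.range_subset_iff.2 fun i => shiftedDatum_halfspace hμ hμL (h i j)
      have := smoothObj_le_of_halfspace (sub_pos.2 hμL)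
        (convexHull_min hsub (convex_halfSpace_le hlin _) hmK)
      rw [hfm]
      linarith
    refine ⟨f, hf, fun i => ?_⟩
    have heq : f (x i) = fv i := le_antisymm (hle i) (by simpa using hlow i (x i))
    refine ⟨heq, fun y => ?_⟩
    have : 0 ≤ μ / 2 * ‖y - x i‖ ^ 2 := by positivity
    rw [heq]
    linarith [hlow i y]

end Interpolation

/-- Function interpolation as a limit of set interpolation: the quantities
`Q^set_{η²μ, η²L}(i,j)(η)` converge as `η → 0⁺` to limits `ℓ i j`, and the family is
`F_{μ,L}`-interpolable iff all these limits are nonnegative. -/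
theorem set_interpolation_limit {d : ℕ} (hd : 1 ≤ d) {ι : Type*} [Fintype ι]
    (μ L : ℝ) (hμ : 0 < μ) (hμL : μ < L) (x g : ι → EuclideanSpace ℝ (Fin d))
    (fv : ι → ℝ) :
    ∃ ℓ : ι → ι → ℝ,
      (∀ i j, Tendsto
        (fun η : ℝ => Qset (η ^ 2 * μ) (η ^ 2 * L) (x i) (g i) (fv i) (x j) (g j) (fv j) η)
        (nhdsWithin 0 (Set.Ioi 0)) (nhds (ℓ i j))) ∧
      (FInterpolable μ L x g fv ↔ ∀ i j, 0 ≤ ℓ i j) := by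
  refine ⟨fun i j => interpGap μ L (x i) (g i) (fv i) (x j) (g j) (fv j),
    fun i j => tendsto_Qset hμ hμL _ _ _ _ _ _, ?_,
    fInterpolable_of_interpGap_nonneg hμ hμL⟩
  rintro ⟨f, hf, hfi⟩ i j
  beta_reduce
  rw [← (hfi i).1, ← (hfi j).1]
  exact interpGap_nonneg_of_memFclass hμ hμL hf (hfi i).2 (hfi j).2
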